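/- arXiv:2501.15783 — 2 statements merged into one kernel-verified Lean document; each statement's English description precedes it below -/
import Mathlib

section
/- Let X be a real Banach space, let μ be Lebesgue measure on [0,1], and let Z = L¹([0,1], μ; X) be the space of Bochner integrable X-valued functions. For any f ∈ L¹([0,1], μ) with ‖f‖₁ = 1 and any x ∈ S_X, the element f⊗x ∈ S_Z given by t ↦ f(t)·x is such that its canonical image in Z** is NOT a Namioka point of B_{Z**}; that is, the identity map from (B_{Z**}, σ(Z**,Z*)) to (B_{Z**}, σ(Z**,Z***)) is not continuous at the canonical image of f⊗x. -/
/-!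
STATEMENT 4: Let `Z = L¹([0,1]; X)` (Bochner-integrable functions, Lebesgue measure).
For any `f ∈ L¹[0,1]` with `‖f‖₁ = 1` and any `x ∈ S_X`, the element `f ⊗ x : t ↦ f t • x`
of `S_Z` is such that its canonical image in `Z**` is NOT a Namioka point of `B_{Z**}`.
-/

noncomputable section

open NormedSpace MeasureTheory

/-- The weak* topology `σ(Z*, Z)` on the dual of a normed space `Z`. -/
def weakStarTop (Z : Type*) [SeminormedAddCommGroup Z] [NormedSpace ℝ Z] :
    TopologicalSpace (Z →L[ℝ] ℝ) :=
  ⨅ z : Z, TopologicalSpace.induced (fun φ : Z →L[ℝ] ℝ => φ z) inferInstance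

/-- The weak topology `σ(Z, Z*)` on a normed space `Z`. -/
def weakTop (Z : Type*) [SeminormedAddCommGroup Z] [NormedSpace ℝ Z] :
    TopologicalSpace Z :=
  ⨅ f : Z →L[ℝ] ℝ, TopologicalSpace.induced (fun z : Z => f z) inferInstance

/-- `z₀` is a Namioka point of the dual unit ball `B_{Z*}`: the identity map from
`(B_{Z*}, σ(Z*,Z))` to `(B_{Z*}, σ(Z*,Z**))` is continuous at `z₀`. -/
def IsNamiokaPoint (Z : Type*) [SeminormedAddCommGroup Z] [NormedSpace ℝ Z]
    (z₀ : Z →L[ℝ] ℝ) : Prop :=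
  @ContinuousWithinAt (Z →L[ℝ] ℝ) (Z →L[ℝ] ℝ) (weakStarTop Z) (weakTop (Z →L[ℝ] ℝ))
    id {φ : Z →L[ℝ] ℝ | ‖φ‖ ≤ 1} z₀

section SmallSupport

open Filter Topology
open scoped ENNReal

variable {α : Type*} [MeasurableSpace α] {μ : Measure α}
  {X : Type*} [NormedAddCommGroup X]

/-- The `L¹` function `z` vanishes almost everywhere outside `E`. -/
def IsSupportedOn (z : Lp X 1 μ) (E : Set α) : Prop :=
  ∀ᵐ t ∂μ, t ∉ E → (z : α → X) t = 0

/-- The measure `μ` admits finite measurable partitions into pieces of arbitrarily small measure. -/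
def HasSmallPartitions (μ : Measure α) : Prop :=
  ∀ ε : ℝ≥0∞, ε ≠ 0 → ∃ (n : ℕ) (p : α → ℕ), Measurable p ∧ (∀ᵐ t ∂μ, p t < n) ∧
    ∀ j, μ (p ⁻¹' {j}) ≤ ε

/-- The unit ball elements of `L¹` whose support has measure at most `ε`. -/
def smallSupportBall (X : Type*) [NormedAddCommGroup X] (μ : Measure α) (ε : ℝ≥0∞) :
    Set (Lp X 1 μ) :=
  {z | ‖z‖ ≤ 1 ∧ ∃ E, MeasurableSet E ∧ μ E ≤ ε ∧ IsSupportedOn z E}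

theorem IsSupportedOn.mono {z : Lp X 1 μ} {E F : Set α} (h : IsSupportedOn z E) (hEF : E ⊆ F) :
    IsSupportedOn z F := by
  filter_upwards [h] with t ht htF using ht fun htE => htF (hEF htE)

theorem IsSupportedOn.sum {ι : Type*} (s : Finset ι) {z : ι → Lp X 1 μ} {E : Set α}
    (h : ∀ i ∈ s, IsSupportedOn (z i) E) : IsSupportedOn (∑ i ∈ s, z i) E := by
  classical
  induction s using Finset.induction_on with
  | empty =>
    filter_upwards [Lp.coeFn_zero X 1 μ] with t ht _
    simpa using ht
  | insert a s ha ih =>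
    rw [Finset.sum_insert ha]
    have h₁ := h a (Finset.mem_insert_self a s)
    have h₂ := ih fun i hi => h i (Finset.mem_insert_of_mem hi)
    filter_upwards [h₁, h₂, Lp.coeFn_add (z a) (∑ i ∈ s, z i)] with t ht₁ ht₂ ht htE
    rw [ht, Pi.add_apply, ht₁ htE, ht₂ htE, add_zero]

variable [NormedSpace ℝ X]

theorem IsSupportedOn.smul {z : Lp X 1 μ} {E : Set α} (h : IsSupportedOn z E) (c : ℝ) :
    IsSupportedOn (c • z) E := by
  filter_upwards [h, Lp.coeFn_smul c z] with t ht hc htE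
  rw [hc, Pi.smul_apply, ht htE, smul_zero]

theorem mem_convexHull_smallSupportBall {ε : ℝ≥0∞} {n : ℕ} {p : α → ℕ} (hp : Measurable p)
    (hpn : ∀ᵐ t ∂μ, p t < n) (hpε : ∀ j, μ (p ⁻¹' {j}) ≤ ε) (g : Lp X 1 μ) (hg : ‖g‖ = 1) :
    g ∈ convexHull ℝ (smallSupportBall X μ ε) := by
  classical
  have hE : ∀ j, MeasurableSet (p ⁻¹' {j}) := fun j => hp (measurableSet_singleton j)
  have hmem : ∀ j, MemLp ((p ⁻¹' {j}).indicator (g : α → X)) 1 μ :=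
    fun j => (Lp.memLp g).indicator (hE j)
  let y : ℕ → Lp X 1 μ := fun j => (hmem j).toLp _
  have hy : ∀ j, (y j : α → X) =ᵐ[μ] (p ⁻¹' {j}).indicator (g : α → X) :=
    fun j => (hmem j).coeFn_toLp
  have hall : ∀ᵐ t ∂μ, ∀ j, (y j : α → X) t = (p ⁻¹' {j}).indicator (g : α → X) t :=
    ae_all_iff.2 hy
  have hsum : ∑ j ∈ Finset.range n, y j = g := by
    apply Lp.ext
    filter_upwards [hall, hpn, Lp.coeFn_finsetSum (Finset.range n) y] with t ht htn hs
    rw [hs, Finset.sum_apply]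
    simp [ht, Set.indicator_apply, htn]
  have hnorm : ∑ j ∈ Finset.range n, ‖y j‖ = 1 := by
    rw [← hg]
    simp_rw [L1.norm_eq_integral_norm]
    rw [← integral_finsetSum _ fun j _ => (L1.integrable_coeFn (y j)).norm]
    apply integral_congr_ae
    filter_upwards [hall, hpn] with t ht htn
    simp [ht, Set.indicator_apply, apply_ite norm, htn]
  have hcomb : ∑ j ∈ Finset.range n, ‖y j‖ • (‖y j‖⁻¹ • y j) = g := by
    rw [← hsum]
    refine Finset.sum_congr rfl fun j _ => ?_
    by_cases h : y j = 0
    · simp [h]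
    · rw [smul_smul, mul_inv_cancel₀ (norm_ne_zero_iff.2 h), one_smul]
  rw [← hcomb]
  refine (convex_convexHull ℝ _).sum_mem (fun _ _ => norm_nonneg _) hnorm fun j _ =>
    subset_convexHull ℝ _ ⟨?_, p ⁻¹' {j}, hE j, hpε j, IsSupportedOn.smul ?_ _⟩
  · rw [norm_smul, norm_inv, norm_norm]
    exact inv_mul_le_one
  · filter_upwards [hy j] with t ht htE
    rw [ht, Set.indicator_of_notMem htE]

theorem exists_smallSupport_eq (hμ : HasSmallPartitions μ) (g : Lp X 1 μ) (hg : ‖g‖ = 1)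
    (I : Finset (Lp X 1 μ →L[ℝ] ℝ)) {ε : ℝ≥0∞} (hε : ε ≠ 0) :
    ∃ z ∈ smallSupportBall X μ ε, ∀ h ∈ I, h z = h g := by
  have hcard : ((I.card : ℝ≥0∞) + 1) ≠ ∞ := by finiteness
  obtain ⟨n, p, hp, hpn, hpε⟩ := hμ (ε / (I.card + 1)) (ENNReal.div_ne_zero.2 ⟨hε, hcard⟩)
  have hconv := mem_convexHull_smallSupportBall hp hpn hpε g hg
  let T : Lp X 1 μ →ₗ[ℝ] (I → ℝ) := LinearMap.pi fun h => (h : Lp X 1 μ →L[ℝ] ℝ).toLinearMap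
  have hT : T g ∈ convexHull ℝ (T '' smallSupportBall X μ (ε / (I.card + 1))) := by
    rw [← T.image_convexHull]
    exact Set.mem_image_of_mem T hconv
  obtain ⟨ι, _, v, w, hv, haff, hw, hw1, hvw⟩ := eq_pos_convex_span_of_mem_convexHull hT
  have hv' : ∀ i, ∃ a ∈ smallSupportBall X μ (ε / (I.card + 1)), T a = v i :=
    fun i => hv (Set.mem_range_self i)
  choose a ha hTa using hv'
  choose ha1 E hEm hEμ hEs using ha
  have hι : Fintype.card ι ≤ I.card + 1 := by
    refine haff.card_le_finrank_succ.trans (Nat.add_le_add_right ?_ 1)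
    refine (Submodule.finrank_le _).trans ?_
    simp
  refine ⟨∑ i, w i • a i, ⟨?_, ⋃ i, E i, MeasurableSet.iUnion hEm, ?_, ?_⟩, fun h hh => ?_⟩
  · calc ‖∑ i, w i • a i‖ ≤ ∑ i, ‖w i • a i‖ := norm_sum_le _ _
      _ ≤ ∑ i, w i := by
        refine Finset.sum_le_sum fun i _ => ?_
        rw [norm_smul, Real.norm_of_nonneg (hw i).le]
        exact mul_le_of_le_one_right (hw i).le (ha1 i)
      _ = 1 := hw1
  · calc μ (⋃ i, E i) ≤ ∑ i, μ (E i) := measure_iUnion_fintype_le μ E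
      _ ≤ ∑ _i : ι, ε / (I.card + 1) := Finset.sum_le_sum fun i _ => hEμ i
      _ = Fintype.card ι * (ε / (I.card + 1)) := by simp
      _ ≤ (I.card + 1) * (ε / (I.card + 1)) := by
        gcongr
        exact_mod_cast hι
      _ = ε := ENNReal.mul_div_cancel (by simp) hcard
  · exact IsSupportedOn.sum _ fun i _ => ((hEs i).mono (Set.subset_iUnion E i)).smul _
  · have h1 : T (∑ i, w i • a i) = T g := by
      rw [map_sum, ← hvw]
      simp_rw [map_smul, hTa]
    exact congrFun h1 ⟨h, hh⟩

theorem exists_continuousLinearMap_eq_zero_of_le_norm_sub {V : Type*} [NormedAddCommGroup V]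
    [NormedSpace ℝ V] (S : Submodule ℝ V) (γ : V) {d : ℝ} (hd : 0 < d)
    (h : ∀ φ ∈ S, d ≤ ‖γ - φ‖) :
    ∃ F : V →L[ℝ] ℝ, (∀ φ ∈ S, F φ = 0) ∧ F γ ≠ 0 := by
  have hγ : γ ∉ closure (S : Set V) := by
    intro hmem
    obtain ⟨φ, hφ, hdist⟩ := Metric.mem_closure_iff.1 hmem d hd
    rw [dist_eq_norm] at hdist
    exact (h φ hφ).not_gt hdist
  have hne : ‖S.mkQ γ‖ ≠ 0 := fun h0 =>
    hγ ((QuotientAddGroup.norm_mk_eq_zero_iff_mem_closure (S := S.toAddSubgroup)).1 h0)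
  obtain ⟨k, -, hk⟩ := exists_dual_vector ℝ (S.mkQ γ) hne
  refine ⟨k.comp S.mkQL, fun φ hφ => ?_, ?_⟩
  · have : S.mkQL φ = 0 := (Submodule.Quotient.mk_eq_zero S).2 hφ
    rw [ContinuousLinearMap.comp_apply, this, map_zero]
  · rw [ContinuousLinearMap.comp_apply, Submodule.mkQL_apply, hk]
    exact_mod_cast hne

/-- The singular elements of `L¹(μ; X)**`: those which, for sets `E` of arbitrarily small measure,
annihilate every functional vanishing on the functions supported on `E`. -/
def singularSubmodule (X : Type*) [NormedAddCommGroup X] [NormedSpace ℝ X] (μ : Measure α) :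
    Submodule ℝ ((Lp X 1 μ →L[ℝ] ℝ) →L[ℝ] ℝ) where
  carrier := {φ | ∀ ε : ℝ≥0∞, ε ≠ 0 → ∃ E, MeasurableSet E ∧ μ E ≤ ε ∧
    ∀ h : Lp X 1 μ →L[ℝ] ℝ, (∀ z, IsSupportedOn z E → h z = 0) → φ h = 0}
  zero_mem' := fun _ _ => ⟨∅, MeasurableSet.empty, by simp, fun _ _ => rfl⟩
  add_mem' := by
    intro φ ψ hφ hψ ε hε
    obtain ⟨E, hE, hEμ, hEφ⟩ := hφ (ε / 2) (ENNReal.half_pos hε).ne'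
    obtain ⟨F, hF, hFμ, hFψ⟩ := hψ (ε / 2) (ENNReal.half_pos hε).ne'
    refine ⟨E ∪ F, hE.union hF, ?_, fun h hh => ?_⟩
    · calc μ (E ∪ F) ≤ μ E + μ F := measure_union_le E F
        _ ≤ ε / 2 + ε / 2 := add_le_add hEμ hFμ
        _ = ε := ENNReal.add_halves ε
    · rw [add_apply, hEφ h fun z hz => hh z (hz.mono Set.subset_union_left),
        hFψ h fun z hz => hh z (hz.mono Set.subset_union_right), add_zero]
  smul_mem' := by
    intro c φ hφ ε hε
    obtain ⟨E, hE, hEμ, hEφ⟩ := hφ ε hε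
    refine ⟨E, hE, hEμ, fun h hh => ?_⟩
    rw [smul_apply, hEφ h hh, smul_zero]

theorem exists_singular_eq (hμ : HasSmallPartitions μ) (g : Lp X 1 μ) (hg : ‖g‖ = 1)
    (I : Finset (Lp X 1 μ →L[ℝ] ℝ)) :
    ∃ φ ∈ singularSubmodule X μ, ‖φ‖ ≤ 1 ∧ ∀ h ∈ I, φ h = h g := by
  obtain ⟨δ, hδ, hδsum⟩ := ENNReal.exists_pos_sum_of_countable' one_ne_zero ℕ
  choose z hz hzI using fun m => exists_smallSupport_eq hμ g hg I (hδ m).ne'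
  choose hz1 E hEm hEμ hEs using hz
  let u : ℕ → WeakDual ℝ (Lp X 1 μ →L[ℝ] ℝ) :=
    fun m => StrongDual.toWeakDual (inclusionInDoubleDual ℝ (Lp X 1 μ) (z m))
  have hu : ∀ m, u m ∈ WeakDual.toStrongDual ⁻¹'
      Metric.closedBall (0 : StrongDual ℝ (Lp X 1 μ →L[ℝ] ℝ)) 1 := by
    intro m
    refine (mem_closedBall_zero_iff (E := StrongDual ℝ (Lp X 1 μ →L[ℝ] ℝ))).2 ?_
    exact (double_dual_bound ℝ (Lp X 1 μ) (z m)).trans (hz1 m)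
  obtain ⟨φ, hφ, hlim⟩ := (WeakDual.isCompact_closedBall (𝕜 := ℝ)
    (0 : StrongDual ℝ (Lp X 1 μ →L[ℝ] ℝ)) 1).ultrafilter_le_nhds
      ((hyperfilter ℕ).map u) (le_principal_iff.2 (Filter.mem_map.2 (univ_mem' hu)))
  have heval : ∀ h : Lp X 1 μ →L[ℝ] ℝ,
      Tendsto (fun m => h (z m)) (hyperfilter ℕ : Filter ℕ) (𝓝 (φ h)) :=
    fun h => ((WeakDual.eval_continuous h).tendsto φ).comp hlim
  have hat : (hyperfilter ℕ : Filter ℕ) ≤ atTop := by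
    rw [← Nat.cofinite_eq_atTop]
    exact hyperfilter_le_cofinite
  refine ⟨WeakDual.toStrongDual φ, ?_, mem_closedBall_zero_iff.1 hφ, fun h hh => ?_⟩
  · intro ε hε
    have htail := ENNReal.tendsto_sum_nat_add δ (hδsum.trans ENNReal.one_lt_top).ne
    obtain ⟨k, hk⟩ := (htail.eventually_lt_const (pos_iff_ne_zero.2 hε)).exists
    refine ⟨⋃ m, E (m + k), MeasurableSet.iUnion fun m => hEm _, ?_, fun h hh => ?_⟩
    · exact (measure_iUnion_le _).trans ((ENNReal.tsum_le_tsum fun m => hEμ _).trans hk.le)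
    · refine tendsto_nhds_unique (heval h) (tendsto_const_nhds.congr' ?_)
      filter_upwards [hat (eventually_ge_atTop k)] with m hm
      refine (hh (z m) ((hEs m).mono ?_)).symm
      have := Set.subset_iUnion (fun m => E (m + k)) (m - k)
      simpa [Nat.sub_add_cancel hm] using this
  · refine tendsto_nhds_unique (heval h) (tendsto_const_nhds.congr fun m => ?_)
    exact (hzI m h hh).symm

theorem half_le_norm_sub_of_mem_singularSubmodule (g : Lp X 1 μ) (hg : ‖g‖ = 1)
    {φ : (Lp X 1 μ →L[ℝ] ℝ) →L[ℝ] ℝ} (hφ : φ ∈ singularSubmodule X μ) :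
    1 / 2 ≤ ‖inclusionInDoubleDual ℝ (Lp X 1 μ) g - φ‖ := by
  have hint : Integrable (g : α → X) μ := L1.integrable_coeFn g
  obtain ⟨δ, hδ, hsmall⟩ := exists_pos_setLIntegral_lt_of_measure_lt (μ := μ)
    (f := fun t => ‖(g : α → X) t‖ₑ) hint.2.ne
    (ε := ENNReal.ofReal (1 / 2)) (by simp)
  obtain ⟨δ', hδ'0, hδ'⟩ := exists_between hδ
  obtain ⟨E, hE, hEμ, hEφ⟩ := hφ δ' hδ'0.ne'
  have hEint : ∫ t in E, ‖(g : α → X) t‖ ∂μ ≤ 1 / 2 := by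
    rw [integral_norm_eq_lintegral_enorm hint.1.restrict]
    exact ENNReal.toReal_le_of_le_ofReal (by norm_num) (hsmall E (hEμ.trans_lt hδ')).le
  let R := LpToLpRestrictCLM α X ℝ μ 1 Eᶜ
  have hR : ‖R‖ ≤ 1 := LinearMap.mkContinuous_norm_le _ zero_le_one _
  have hRg : 1 / 2 ≤ ‖R g‖ := by
    have h1 : ‖R g‖ = ∫ t in Eᶜ, ‖(g : α → X) t‖ ∂μ := by
      rw [L1.norm_eq_integral_norm]
      refine integral_congr_ae ?_
      filter_upwards [LpToLpRestrictCLM_coeFn ℝ Eᶜ g] with t ht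
      rw [ht]
    have h2 := integral_add_compl hE hint.norm
    rw [← L1.norm_eq_integral_norm, hg] at h2
    linarith
  obtain ⟨k, hk, hkg⟩ := exists_dual_vector'' ℝ (R g)
  have hzero : φ (k.comp R) = 0 := by
    refine hEφ _ fun z hz => ?_
    have : R z = 0 := by
      apply Lp.ext
      filter_upwards [LpToLpRestrictCLM_coeFn ℝ Eᶜ z, Lp.coeFn_zero X 1 (μ.restrict Eᶜ),
        ae_restrict_of_ae hz, ae_restrict_mem hE.compl] with t h1 h2 h3 h4
      rw [h1, h2, h3 h4, Pi.zero_apply]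
    rw [ContinuousLinearMap.comp_apply, this, map_zero]
  have hnorm : ‖k.comp R‖ ≤ 1 :=
    (k.opNorm_comp_le R).trans (mul_le_one₀ hk (norm_nonneg _) hR)
  calc 1 / 2 ≤ ‖R g‖ := hRg
    _ = (inclusionInDoubleDual ℝ (Lp X 1 μ) g - φ) (k.comp R) := by
      rw [sub_apply, hzero, sub_zero, dual_def, ContinuousLinearMap.comp_apply, hkg]
      rfl
    _ ≤ ‖(inclusionInDoubleDual ℝ (Lp X 1 μ) g - φ) (k.comp R)‖ := Real.le_norm_self _
    _ ≤ ‖inclusionInDoubleDual ℝ (Lp X 1 μ) g - φ‖ :=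
      ContinuousLinearMap.unit_le_opNorm _ _ hnorm

theorem exists_functional_singularSubmodule_eq_zero (g : Lp X 1 μ) (hg : ‖g‖ = 1) :
    ∃ F : ((Lp X 1 μ →L[ℝ] ℝ) →L[ℝ] ℝ) →L[ℝ] ℝ,
      (∀ φ ∈ singularSubmodule X μ, F φ = 0) ∧ F (inclusionInDoubleDual ℝ (Lp X 1 μ) g) ≠ 0 :=
  exists_continuousLinearMap_eq_zero_of_le_norm_sub (V := (Lp X 1 μ →L[ℝ] ℝ) →L[ℝ] ℝ)
    (singularSubmodule X μ) _ one_half_pos fun _ hφ =>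
      half_le_norm_sub_of_mem_singularSubmodule g hg hφ

theorem not_isNamiokaPoint_of_norm_eq_one (hμ : HasSmallPartitions μ) (g : Lp X 1 μ)
    (hg : ‖g‖ = 1) :
    ¬ IsNamiokaPoint (Lp X 1 μ →L[ℝ] ℝ) (inclusionInDoubleDual ℝ (Lp X 1 μ) g) := by
  intro hN
  obtain ⟨F, hF, hFg⟩ := exists_functional_singularSubmodule_eq_zero g hg
  choose φ hφ hφ1 hφI using fun I => exists_singular_eq hμ g hg I
  have hlim : Tendsto φ atTop (@nhds _ (weakStarTop (Lp X 1 μ →L[ℝ] ℝ))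
      (inclusionInDoubleDual ℝ (Lp X 1 μ) g)) := by
    rw [weakStarTop, nhds_iInf]
    refine tendsto_iInf.2 fun h => ?_
    rw [nhds_induced, tendsto_comap_iff]
    refine tendsto_const_nhds.congr' ?_
    filter_upwards [eventually_ge_atTop {h}] with I hI
    exact (hφI I h (hI (Finset.mem_singleton_self h))).symm
  have hweak : @nhds _ (weakTop ((Lp X 1 μ →L[ℝ] ℝ) →L[ℝ] ℝ))
      (inclusionInDoubleDual ℝ (Lp X 1 μ) g) ≤
      comap F (𝓝 (F (inclusionInDoubleDual ℝ (Lp X 1 μ) g))) := by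
    rw [weakTop, nhds_iInf]
    exact (iInf_le _ F).trans_eq (nhds_induced _ _)
  have hFlim : Tendsto (fun I => F (φ I)) atTop
      (𝓝 (F (inclusionInDoubleDual ℝ (Lp X 1 μ) g))) := by
    have hid : Tendsto id (@nhds _ (weakStarTop (Lp X 1 μ →L[ℝ] ℝ))
        (inclusionInDoubleDual ℝ (Lp X 1 μ) g) ⊓
          𝓟 {φ : (Lp X 1 μ →L[ℝ] ℝ) →L[ℝ] ℝ | ‖φ‖ ≤ 1})
        (@nhds _ (weakTop ((Lp X 1 μ →L[ℝ] ℝ) →L[ℝ] ℝ))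
          (inclusionInDoubleDual ℝ (Lp X 1 μ) g)) := hN
    exact (tendsto_comap_iff.1 (hid.mono_right hweak)).comp
      (tendsto_inf.2 ⟨hlim, tendsto_principal.2 (Eventually.of_forall hφ1)⟩)
  refine hFg (tendsto_nhds_unique hFlim (tendsto_const_nhds.congr fun I => ?_))
  exact (hF _ (hφ I)).symm

end SmallSupport

theorem hasSmallPartitions_restrict_Icc :
    HasSmallPartitions ((volume : Measure ℝ).restrict (Set.Icc 0 1)) := by
  intro ε hε
  obtain ⟨N, hN⟩ := ENNReal.exists_inv_nat_lt hε
  have hN0 : N ≠ 0 := by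
    rintro rfl
    simp at hN
  have hNpos : (0 : ℝ) < N := by positivity
  refine ⟨N + 1, fun t => ⌊N * t⌋₊, Nat.measurable_floor.comp (measurable_const_mul _), ?_,
    fun j => ?_⟩
  · filter_upwards [ae_restrict_mem measurableSet_Icc] with t ht
    rw [Nat.lt_succ_iff]
    refine Nat.floor_le_of_le ?_
    exact mul_le_of_le_one_right hNpos.le ht.2
  · have hsub : (fun t : ℝ => ⌊N * t⌋₊) ⁻¹' {j} ∩ Set.Icc 0 1 ⊆
        Set.Icc ((j : ℝ) / N) ((j + 1 : ℝ) / N) := by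
      rintro t ⟨rfl, ht⟩
      rw [Set.mem_Icc, div_le_iff₀' hNpos, le_div_iff₀' hNpos]
      exact ⟨Nat.floor_le (mul_nonneg hNpos.le ht.1), (Nat.lt_floor_add_one _).le⟩
    rw [Measure.restrict_apply' measurableSet_Icc]
    refine (measure_mono hsub).trans ?_
    rw [Real.volume_Icc, ← sub_div, add_sub_cancel_left, one_div, ENNReal.ofReal_inv_of_pos hNpos,
      ENNReal.ofReal_natCast]
    exact hN.le

theorem stmt4 (X : Type*) [NormedAddCommGroup X] [NormedSpace ℝ X] [CompleteSpace X]
    (μ : Measure ℝ) (hμ : μ = volume.restrict (Set.Icc 0 1))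
    (f : Lp ℝ 1 μ) (hf : ‖f‖ = 1) (x : X) (hx : ‖x‖ = 1)
    (g : Lp X 1 μ) (hg : (g : ℝ → X) =ᵐ[μ] fun t => (f : ℝ → ℝ) t • x) :
    ¬ IsNamiokaPoint (Lp X 1 μ →L[ℝ] ℝ)
        (inclusionInDoubleDual ℝ (Lp X 1 μ) g) := by
  have hg1 : ‖g‖ = 1 := by
    rw [← hf, L1.norm_eq_integral_norm, L1.norm_eq_integral_norm]
    refine integral_congr_ae ?_
    filter_upwards [hg] with t ht
    rw [ht, norm_smul, hx, mul_one]
  subst hμ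
  exact not_isNamiokaPoint_of_norm_eq_one hasSmallPartitions_restrict_Icc g hg1

end
end

section
/- The unit sphere of C([0,1],ℝ)* contains no Namioka points: for every μ ∈ C([0,1],ℝ)* with ‖μ‖ = 1, the identity map from (B_{C([0,1],ℝ)*}, weak* topology σ(C([0,1])*, C([0,1]))) to (B_{C([0,1],ℝ)*}, weak topology σ(C([0,1])*, C([0,1])**)) is not continuous at μ. -/
/-!
STATEMENT 14: The unit sphere of `C([0,1], ℝ)*` contains no Namioka points: for every
norm-one `μ ∈ C([0,1], ℝ)*`, the identity map from `(B_{C([0,1])*}, weak*)` to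
`(B_{C([0,1])*}, weak)` is not continuous at `μ`.
-/

noncomputable section

/-- A Namioka point lies in the norm closure of every convex subset of the dual ball that is not
separated from it by a weak*-continuous functional. -/
theorem IsNamiokaPoint.mem_closure {Z : Type*} [SeminormedAddCommGroup Z] [NormedSpace ℝ Z]
    {μ : Z →L[ℝ] ℝ} (h : IsNamiokaPoint Z μ) {A : Set (Z →L[ℝ] ℝ)} (hA : Convex ℝ A)
    (hball : ∀ φ ∈ A, ‖φ‖ ≤ 1) (hsep : ∀ z c, (∀ φ ∈ A, φ z ≤ c) → μ z ≤ c) :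
    μ ∈ closure A := by
  by_contra hμ
  obtain ⟨G, u, hGμ, hGA⟩ := geometric_hahn_banach_point_closed hA.closure isClosed_closure hμ
  have hweak : {φ : Z →L[ℝ] ℝ | G φ < u} ∈ @nhds _ (weakTop (Z →L[ℝ] ℝ)) (id μ) := by
    rw [weakTop, nhds_iInf]
    refine Filter.mem_iInf_of_mem G ?_
    rw [nhds_induced]
    exact Filter.preimage_mem_comap (Iio_mem_nhds hGμ)
  have hpre := h hweak
  rw [Filter.mem_map, @mem_nhdsWithin_iff_exists_mem_nhds_inter _ (weakStarTop Z)] at hpre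
  obtain ⟨V, hV, hVG⟩ := hpre
  have hind : weakStarTop Z =
      TopologicalSpace.induced (fun (φ : Z →L[ℝ] ℝ) (z : Z) => φ z) Pi.topologicalSpace := by
    simp only [weakStarTop, Pi.topologicalSpace, induced_iInf, induced_compose]
    rfl
  rw [hind, nhds_induced, Filter.mem_comap] at hV
  obtain ⟨W, hW, hWV⟩ := hV
  rw [nhds_pi, Filter.mem_pi'] at hW
  obtain ⟨I, t, ht, htW⟩ := hW
  classical
  let T : (Z →L[ℝ] ℝ) →ₗ[ℝ] (I → ℝ) :=
    { toFun := fun φ i => φ i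
      map_add' := fun _ _ => rfl
      map_smul' := fun _ _ => rfl }
  have hT : T μ ∈ closure (T '' A) := by
    by_contra hnot
    obtain ⟨L, c, hLA, hLμ⟩ :=
      geometric_hahn_banach_closed_point (hA.linear_image T).closure isClosed_closure hnot
    have hL : ∀ φ : Z →L[ℝ] ℝ, L (T φ) = φ (∑ i : I, L (Pi.single i 1) • (i : Z)) := by
      intro φ
      rw [map_sum]
      refine (L.toLinearMap.pi_apply_eq_sum_univ (T φ)).trans ?_
      refine Finset.sum_congr rfl fun i _ => ?_
      have hs : (fun j => if i = j then (1 : ℝ) else 0) = Pi.single i 1 := by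
        ext j
        simp [Pi.single_apply, eq_comm]
      rw [hs, map_smul, smul_eq_mul, smul_eq_mul, mul_comm]
      rfl
    rw [hL] at hLμ
    refine absurd (hsep _ c fun φ hφ => ?_) hLμ.not_ge
    rw [← hL]
    exact (hLA _ (subset_closure ⟨φ, hφ, rfl⟩)).le
  obtain ⟨_, hφt, φ, hφ, rfl⟩ := mem_closure_iff_nhds.1 hT (Set.univ.pi fun i : I => t i)
    (set_pi_mem_nhds Set.finite_univ fun i _ => ht i)
  have hφV : φ ∈ V := hWV (htW fun i hi => hφt ⟨i, hi⟩ trivial)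
  exact lt_asymm (hGA φ (subset_closure hφ)) (hVG ⟨hφV, hball φ hφ⟩)

/-- The dual of `Z`, for the topology that comes from the norm of `Z`. -/
abbrev NormedDual (Z : Type*) [SeminormedAddCommGroup Z] [NormedSpace ℝ Z] : Type _ :=
  Z →L[ℝ] ℝ

/-- The functionals in the dual ball of `C(X, ℝ)` supported on a finite subset of `S`. -/
def finitelySupportedBall {X : Type*} [TopologicalSpace X] [CompactSpace X] (S : Set X) :
    Set (NormedDual C(X, ℝ)) :=
  {φ | ‖φ‖ ≤ 1 ∧ ∃ F : Set X, F.Finite ∧ F ⊆ S ∧ ∀ f : C(X, ℝ), (∀ x ∈ F, f x = 0) → φ f = 0}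

section

variable {X : Type*} [TopologicalSpace X] [CompactSpace X]

theorem convex_finitelySupportedBall (S : Set X) : Convex ℝ (finitelySupportedBall S) := by
  rintro φ ⟨hφ, F, hF, hFS, hφF⟩ ψ ⟨hψ, F', hF', hFS', hψF⟩ a b ha hb hab
  refine ⟨?_, F ∪ F', hF.union hF', Set.union_subset hFS hFS', fun f hf => ?_⟩
  · have := convex_closedBall (0 : NormedDual C(X, ℝ)) 1 (x := φ) (by simpa using hφ) (y := ψ)
      (by simpa using hψ) ha hb hab
    simpa using this
  · simp [hφF f fun x hx => hf x (Or.inl hx), hψF f fun x hx => hf x (Or.inr hx)]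

theorem le_of_forall_finitelySupportedBall_le {S : Set X} (hS : Dense S)
    {μ : NormedDual C(X, ℝ)} (hμ : ‖μ‖ ≤ 1) (f : C(X, ℝ)) (c : ℝ)
    (h : ∀ φ ∈ finitelySupportedBall S, φ f ≤ c) : μ f ≤ c := by
  have hc : 0 ≤ c := by
    simpa using h 0 ⟨by simp, ∅, Set.finite_empty, Set.empty_subset _, fun _ _ => rfl⟩
  have hS' : ∀ x ∈ S, |f x| ≤ c := by
    intro x hx
    let δ : NormedDual C(X, ℝ) := ContinuousMap.evalCLM ℝ x
    have hδ : ‖δ‖ ≤ 1 :=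
      ContinuousLinearMap.opNorm_le_bound _ zero_le_one fun g => by
        simpa [δ] using g.norm_coe_le_norm x
    refine abs_le'.2 ⟨?_, ?_⟩
    · exact h δ ⟨hδ, {x}, Set.finite_singleton x, by simpa using hx,
        fun g hg => hg x rfl⟩
    · exact h (-δ) ⟨by rwa [norm_neg], {x}, Set.finite_singleton x,
        by simpa using hx, fun g hg => neg_eq_zero.2 (hg x rfl)⟩
  have hall : ∀ x, |f x| ≤ c := fun x =>
    closure_minimal (t := {x | |f x| ≤ c}) hS' (isClosed_le (by fun_prop) continuous_const) (hS x)
  calc μ f ≤ ‖μ f‖ := le_abs_self _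
    _ ≤ 1 * ‖f‖ := μ.le_of_opNorm_le hμ f
    _ ≤ c := by rw [one_mul]; exact (ContinuousMap.norm_le f hc).2 hall

theorem norm_le_norm_sub_of_finitelySupportedBall [T2Space X] {S S' : Set X}
    (hSS' : Disjoint S S') {φ ψ : NormedDual C(X, ℝ)} (hφ : φ ∈ finitelySupportedBall S)
    (hψ : ψ ∈ finitelySupportedBall S') : ‖φ‖ ≤ ‖φ - ψ‖ := by
  obtain ⟨-, F, hF, hFS, hφF⟩ := hφ
  obtain ⟨-, F', hF', hFS', hψF⟩ := hψ
  obtain ⟨h, h0, h1, h01⟩ := exists_continuous_zero_one_of_isClosed hF'.isClosed hF.isClosed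
    (hSS'.symm.mono hFS' hFS)
  refine ContinuousLinearMap.opNorm_le_bound _ (norm_nonneg _) fun f => ?_
  have hφf : φ f = φ (h * f) := by
    rw [← sub_eq_zero, ← map_sub]
    exact hφF _ fun x hx => by simp [h1 hx]
  have hψf : ψ (h * f) = 0 := hψF _ fun x hx => by simp [h0 hx]
  have hh : ‖h‖ ≤ 1 := (ContinuousMap.norm_le h zero_le_one).2 fun x => by
    rw [Real.norm_eq_abs, abs_of_nonneg (h01 x).1]
    exact (h01 x).2
  calc ‖φ f‖ = ‖(φ - ψ) (h * f)‖ := by simp [hφf, hψf]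
    _ ≤ ‖φ - ψ‖ * ‖h * f‖ := (φ - ψ).le_opNorm _
    _ ≤ ‖φ - ψ‖ * ‖f‖ := by
      gcongr
      calc ‖h * f‖ ≤ ‖h‖ * ‖f‖ := norm_mul_le _ _
        _ ≤ ‖f‖ := mul_le_of_le_one_left (norm_nonneg _) hh

/-- If `X` has two disjoint dense subsets, the unit sphere of `C(X, ℝ)*` has no Namioka points. -/
theorem not_isNamiokaPoint_of_disjoint_dense [T2Space X] {S S' : Set X} (hS : Dense S)
    (hS' : Dense S') (hSS' : Disjoint S S') {μ : NormedDual C(X, ℝ)} (hμ : ‖μ‖ = 1) :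
    ¬ IsNamiokaPoint C(X, ℝ) μ := by
  intro h
  have key : ∀ {S : Set X}, Dense S → ∃ φ ∈ finitelySupportedBall S, dist μ φ < 1 / 4 :=
    fun {S} hS => Metric.mem_closure_iff.1 (h.mem_closure (convex_finitelySupportedBall S)
      (fun _ hφ => hφ.1) (le_of_forall_finitelySupportedBall_le hS hμ.le)) _ (by norm_num)
  obtain ⟨φ, hφ, hμφ⟩ := key hS
  obtain ⟨ψ, hψ, hμψ⟩ := key hS'
  have h1 := norm_le_norm_sub_of_finitelySupportedBall hSS' hφ hψ
  have h2 := dist_triangle_left φ ψ μ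
  have h3 := norm_le_norm_add_norm_sub' μ φ
  rw [← dist_eq_norm] at h1 h3
  linarith

end

theorem Dense.preimage_val_Icc {s : Set ℝ} (hs : Dense s) :
    Dense ((↑) ⁻¹' s : Set (Set.Icc (0 : ℝ) 1)) := by
  rw [Subtype.dense_iff, Subtype.image_preimage_coe, ← closure_Ioo zero_ne_one]
  refine closure_minimal ?_ isClosed_closure
  refine (hs.open_subset_closure_inter isOpen_Ioo).trans (closure_mono ?_)
  rw [closure_Ioo zero_ne_one]
  exact Set.inter_subset_inter_left _ Set.Ioo_subset_Icc_self

theorem stmt14 (μ : C(Set.Icc (0:ℝ) 1, ℝ) →L[ℝ] ℝ) (hμ : ‖μ‖ = 1) :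
    ¬ IsNamiokaPoint C(Set.Icc (0:ℝ) 1, ℝ) μ := by
  refine not_isNamiokaPoint_of_disjoint_dense Rat.denseRange_cast.preimage_val_Icc
    dense_irrational.preimage_val_Icc ?_ hμ
  exact Set.disjoint_left.2 fun x hx hx' => hx' hx

end
end
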